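/- arXiv:1312.4426 — 2 statements merged into one kernel-verified Lean document; each statement's English description precedes it below -/
import Mathlib

section
/- Let A be a real m₁×n₁ matrix satisfying RIP(k, δ_A) and let B be a real m₂×n₂ matrix satisfying RIP(k, δ_B), with δ_A, δ_B ≥ 0. Then the Kronecker product U = B ⊗ A (an (m₁m₂)×(n₁n₂) real matrix) satisfies RIP(k, δ) with δ = (1+δ_A)(1+δ_B) − 1; that is, for every vector h ∈ ℝ^{n₁n₂} with at most k nonzero entries, (2 − (1+δ_A)(1+δ_B))‖h‖₂² ≤ ‖U h‖₂² ≤ (1+δ_A)(1+δ_B)‖h‖₂². -/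
open Matrix Finset

/-- `U` satisfies the restricted isometry property of order `k` with constant `δ`:
for every `k`-sparse vector `h`, `(1-δ)‖h‖₂² ≤ ‖Uh‖₂² ≤ (1+δ)‖h‖₂²`. -/
def RIP {M N : Type*} [Fintype M] [Fintype N] (U : Matrix M N ℝ) (k : ℕ) (δ : ℝ) : Prop :=
  ∀ h : N → ℝ, (Finset.univ.filter fun j => h j ≠ 0).card ≤ k →
    (1 - δ) * ∑ j, h j ^ 2 ≤ ∑ i, (U.mulVec h i) ^ 2 ∧
    ∑ i, (U.mulVec h i) ^ 2 ≤ (1 + δ) * ∑ j, h j ^ 2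

theorem kroneckerMap_mul_mulVec_apply {M₁ N₁ M₂ N₂ : Type*} [Fintype N₁] [Fintype N₂]
    (A : Matrix M₁ N₁ ℝ) (B : Matrix M₂ N₂ ℝ) (h : N₂ × N₁ → ℝ) (i₂ : M₂) (i₁ : M₁) :
    (Matrix.kroneckerMap (· * ·) B A).mulVec h (i₂, i₁) =
      B.mulVec (fun j₂ => A.mulVec (fun j₁ => h (j₂, j₁)) i₁) i₂ := by
  simp only [Matrix.mulVec, dotProduct, Fintype.sum_prod_type, Matrix.kroneckerMap_apply,
    Finset.mul_sum, mul_assoc]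

theorem card_support_row_le {N₁ N₂ : Type*} [Fintype N₁] [Fintype N₂]
    (h : N₂ × N₁ → ℝ) (j₂ : N₂) :
    (Finset.univ.filter fun j₁ => h (j₂, j₁) ≠ 0).card ≤
      (Finset.univ.filter fun j => h j ≠ 0).card := by
  refine Finset.card_le_card_of_injOn (fun j₁ => (j₂, j₁)) ?_ ?_
  · intro j₁ hj
    simpa using hj
  · intro a _ b _ hab
    exact (Prod.mk.inj hab).2

theorem card_support_mulVec_rows_le {M₁ N₁ N₂ : Type*} [Fintype N₁] [Fintype N₂]
    (A : Matrix M₁ N₁ ℝ) (h : N₂ × N₁ → ℝ) (i₁ : M₁) :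
    (Finset.univ.filter fun j₂ => A.mulVec (fun j₁ => h (j₂, j₁)) i₁ ≠ 0).card ≤
      (Finset.univ.filter fun j => h j ≠ 0).card := by
  classical
  refine (Finset.card_le_card fun j₂ hj => ?_).trans
    (Finset.card_image_le (f := Prod.fst) (s := Finset.univ.filter fun j => h j ≠ 0))
  have hne := (Finset.mem_filter.mp hj).2
  obtain ⟨j₁, -, hj₁⟩ := Finset.exists_ne_zero_of_sum_ne_zero hne
  exact Finset.mem_image.mpr
    ⟨(j₂, j₁), Finset.mem_filter.mpr ⟨Finset.mem_univ _, right_ne_zero_of_mul hj₁⟩, rfl⟩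

/-- If `A` satisfies RIP(k, δ_A) and `B` satisfies RIP(k, δ_B), then the Kronecker
product `B ⊗ A` satisfies RIP(k, (1+δ_A)(1+δ_B) - 1). -/
theorem kronecker_RIP {m₁ n₁ m₂ n₂ : ℕ}
    (A : Matrix (Fin m₁) (Fin n₁) ℝ) (B : Matrix (Fin m₂) (Fin n₂) ℝ)
    (k : ℕ) (δA δB : ℝ) (hδA : 0 ≤ δA) (hδB : 0 ≤ δB)
    (hA : RIP A k δA) (hB : RIP B k δB) :
    RIP (Matrix.kroneckerMap (· * ·) B A) k ((1 + δA) * (1 + δB) - 1) := by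
  intro h hk
  have hA' := fun j₂ => hA (fun j₁ => h (j₂, j₁)) ((card_support_row_le h j₂).trans hk)
  have hB' := fun i₁ => hB (fun j₂ => A.mulVec (fun j₁ => h (j₂, j₁)) i₁)
    ((card_support_mulVec_rows_le A h i₁).trans hk)
  have hAl := Finset.sum_le_sum fun j₂ (_ : j₂ ∈ Finset.univ) => (hA' j₂).1
  have hAu := Finset.sum_le_sum fun j₂ (_ : j₂ ∈ Finset.univ) => (hA' j₂).2
  have hBl := Finset.sum_le_sum fun i₁ (_ : i₁ ∈ Finset.univ) => (hB' i₁).1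
  have hBu := Finset.sum_le_sum fun i₁ (_ : i₁ ∈ Finset.univ) => (hB' i₁).2
  rw [← Finset.mul_sum, ← Fintype.sum_prod_type (fun j => h j ^ 2)] at hAl hAu
  have hcomm := Finset.sum_comm (s := Finset.univ) (t := Finset.univ)
    (f := fun i₁ j₂ => (A.mulVec (fun j₁ => h (j₂, j₁)) i₁) ^ 2)
  rw [← Finset.mul_sum, hcomm] at hBl hBu
  have hU : ∑ i, ((Matrix.kroneckerMap (· * ·) B A).mulVec h i) ^ 2 =
      ∑ i₁, ∑ i₂, (B.mulVec (fun j₂ => A.mulVec (fun j₁ => h (j₂, j₁)) i₁) i₂) ^ 2 := by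
    simp only [Fintype.sum_prod_type_right, kroneckerMap_mul_mulVec_apply]
  rw [hU]
  have hh : 0 ≤ ∑ j, h j ^ 2 := Finset.sum_nonneg fun j _ => sq_nonneg (h j)
  have hT : 0 ≤ ∑ i₁, ∑ i₂,
      (B.mulVec (fun j₂ => A.mulVec (fun j₁ => h (j₂, j₁)) i₁) i₂) ^ 2 :=
    Finset.sum_nonneg fun _ _ => Finset.sum_nonneg fun _ _ => sq_nonneg _
  have hAB := mul_nonneg hδA hδB
  constructor
  · rcases le_total δB 1 with h1 | h1
    · have hmul := mul_le_mul_of_nonneg_left hAl (sub_nonneg.mpr h1)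
      nlinarith [mul_nonneg hAB hh]
    · refine le_trans (mul_nonpos_of_nonpos_of_nonneg ?_ hh) hT
      linarith
  · have hmul := mul_le_mul_of_nonneg_left hAu (by linarith : 0 ≤ 1 + δB)
    linarith
end

section
/- Let A be a real m×n matrix and y ∈ ℝᵐ, and suppose the system A x = y is feasible (there exists x with A x = y). Then there exists a finite λ₀ ≥ 0 such that for every λ > λ₀, every minimizer (x̂, ε̂) of ‖x‖₁ + λ‖ε‖₁ over all (x, ε) with A x + ε = y satisfies ε̂ = 0 and x̂ minimizes ‖x‖₁ over {x : A x = y}. -/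
open Matrix Finset

/-- Every linear map between vector spaces has a generalized inverse. -/
theorem LinearMap.exists_generalized_inverse {K V W : Type*} [DivisionRing K]
    [AddCommGroup V] [Module K V] [AddCommGroup W] [Module K W] (f : V →ₗ[K] W) :
    ∃ g : W →ₗ[K] V, ∀ x, f (g (f x)) = f x := by
  obtain ⟨g, hg⟩ := f.rangeRestrict.exists_rightInverse_of_surjective f.range_rangeRestrict
  obtain ⟨G, hG⟩ := g.exists_extend
  refine ⟨G, fun x => ?_⟩
  have h₁ : G (f x) = g (f.rangeRestrict x) := LinearMap.congr_fun hG (f.rangeRestrict x)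
  rw [h₁]
  exact congrArg Subtype.val (LinearMap.congr_fun hg (f.rangeRestrict x))

/-- A matrix is bounded with respect to the `ℓ¹` norms by the sum of its absolute entries. -/
theorem Matrix.sum_abs_mulVec_le {m n : Type*} [Fintype m] [Fintype n]
    (B : Matrix m n ℝ) (v : n → ℝ) :
    ∑ i, |(B.mulVec v) i| ≤ (∑ i, ∑ j, |B i j|) * ∑ j, |v j| := by
  rw [Finset.sum_mul]
  refine Finset.sum_le_sum fun i _ => ?_
  calc |(B.mulVec v) i| ≤ ∑ j, |B i j| * |v j| := by
        simpa only [Matrix.mulVec, dotProduct, abs_mul] using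
          Finset.abs_sum_le_sum_abs (fun j => B i j * v j) Finset.univ
    _ ≤ ∑ j, |B i j| * ∑ k, |v k| := by
        gcongr with j
        exact Finset.single_le_sum (f := fun k => |v k|) (fun k _ => abs_nonneg _)
          (Finset.mem_univ j)
    _ = (∑ j, |B i j|) * ∑ k, |v k| := (Finset.sum_mul ..).symm

/-- Exact penalty: if `Ax = y` is feasible, there is a finite `λ₀ ≥ 0` such that for
every `λ > λ₀`, every minimizer `(x̂, ε̂)` of `‖x‖₁ + λ‖ε‖₁` subject to `Ax + ε = y`
has `ε̂ = 0` and `x̂` minimizes `‖x‖₁` over `{x : Ax = y}`. -/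
theorem exact_penalty_basis_pursuit {m n : ℕ}
    (A : Matrix (Fin m) (Fin n) ℝ) (y : Fin m → ℝ)
    (hfeas : ∃ x : Fin n → ℝ, A.mulVec x = y) :
    ∃ lam₀ : ℝ, 0 ≤ lam₀ ∧
      ∀ lam : ℝ, lam > lam₀ →
        ∀ xh : Fin n → ℝ, ∀ εh : Fin m → ℝ,
          A.mulVec xh + εh = y →
          (∀ x : Fin n → ℝ, ∀ ε : Fin m → ℝ, A.mulVec x + ε = y →
            (∑ j, |xh j|) + lam * (∑ i, |εh i|) ≤
              (∑ j, |x j|) + lam * (∑ i, |ε i|)) →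
          εh = 0 ∧ A.mulVec xh = y ∧
            ∀ x : Fin n → ℝ, A.mulVec x = y → (∑ j, |xh j|) ≤ ∑ j, |x j| := by
  obtain ⟨g, hg⟩ := A.mulVecLin.exists_generalized_inverse
  obtain ⟨x₀, hx₀⟩ := hfeas
  set B := LinearMap.toMatrix' g
  refine ⟨∑ i, ∑ j, |B i j|, by positivity, fun lam hlam xh εh hadd hmin => ?_⟩
  have hrange : εh = A.mulVec (x₀ - xh) := by
    rw [Matrix.mulVec_sub, hx₀, ← hadd, add_sub_cancel_left]
  have hinv : A.mulVec (B.mulVec εh) = εh := by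
    rw [LinearMap.toMatrix'_mulVec, hrange]
    exact hg _
  have hle := hmin (xh + B.mulVec εh) 0 (by rw [Matrix.mulVec_add, hinv, hadd, add_zero])
  have htri : ∑ j, |(xh + B.mulVec εh) j| ≤ ∑ j, |xh j| + ∑ j, |(B.mulVec εh) j| := by
    rw [← Finset.sum_add_distrib]
    exact Finset.sum_le_sum fun j _ => abs_add_le _ _
  have hbound := B.sum_abs_mulVec_le εh
  have hnonneg : 0 ≤ ∑ i, |εh i| := by positivity
  simp only [Pi.zero_apply, abs_zero, Finset.sum_const_zero, mul_zero, add_zero] at hle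
  have hsum : ∑ i, |εh i| = 0 := by nlinarith
  have hzero : εh = 0 := by
    ext i
    exact abs_eq_zero.mp
      ((Finset.sum_eq_zero_iff_of_nonneg fun i _ => abs_nonneg (εh i)).mp hsum i
        (Finset.mem_univ i))
  subst hzero
  refine ⟨rfl, by simpa using hadd, fun x hx => ?_⟩
  simpa using hmin x 0 (by simpa using hx)
end
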